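/- arXiv:2103.02987 — 2 statements merged into one kernel-verified Lean document; each statement's English description precedes it below -/
import Mathlib

section
/- Let M be a real symmetric n×n matrix with (1/ω̄)·I ⪯ M ⪯ (1/ω)·I and Γ a real symmetric positive definite p×p matrix with γ·I ⪯ Γ ⪯ γ̄·I, where ω, ω̄, γ, γ̄ > 0. Let θ ∈ ℝᵖ with ‖θ‖ ≤ θ̄, let e ∈ ℝⁿ, θ̃ ∈ ℝᵖ, θ̂ = θ̃ + θ, let d ∈ ℝⁿ with ‖d‖ ≤ d̄, σ ≥ 0, and define V = eᵀM e + θ̃ᵀΓ⁻¹θ̃ and d̄_a = σ·√γ̄·θ̄ + d̄/√ω. Then -σ·θ̃ᵀθ̂ + eᵀM d ≤ -σ‖θ̃‖² + d̄_a·√V. -/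
open Matrix

theorem Matrix.PosSemidef.dotProduct_mulVec_nonneg_real {ι : Type*} [Fintype ι]
    {A : Matrix ι ι ℝ} (hA : A.PosSemidef) (x : ι → ℝ) : 0 ≤ x ⬝ᵥ A *ᵥ x := by
  simpa using hA.dotProduct_mulVec_nonneg x

theorem Matrix.PosSemidef.dotProduct_mulVec_sq_le {ι : Type*} [Fintype ι]
    {A : Matrix ι ι ℝ} (hA : A.PosSemidef) (x y : ι → ℝ) :
    (x ⬝ᵥ A *ᵥ y) ^ 2 ≤ (x ⬝ᵥ A *ᵥ x) * (y ⬝ᵥ A *ᵥ y) := by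
  have hsymm : y ⬝ᵥ A *ᵥ x = x ⬝ᵥ A *ᵥ y := by
    have hT : Aᵀ = A := by simpa [Matrix.IsHermitian] using hA.isHermitian
    rw [dotProduct_comm, dotProduct_mulVec, ← mulVec_transpose, hT]
  have h : ∀ t : ℝ, 0 ≤ (y ⬝ᵥ A *ᵥ y) * (t * t) + 2 * (x ⬝ᵥ A *ᵥ y) * t + x ⬝ᵥ A *ᵥ x := by
    intro t
    have := hA.dotProduct_mulVec_nonneg_real (x + t • y)
    simp only [mulVec_add, mulVec_smul, add_dotProduct, dotProduct_add, smul_dotProduct,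
      dotProduct_smul, smul_eq_mul, hsymm] at this
    linarith
  have := discrim_le_zero h
  unfold discrim at this
  linarith

theorem dotProduct_mulVec_le_of_smul_one_sub_posSemidef {ι : Type*} [Fintype ι] [DecidableEq ι]
    {A : Matrix ι ι ℝ} {c : ℝ} (h : (c • (1 : Matrix ι ι ℝ) - A).PosSemidef) (x : ι → ℝ) :
    x ⬝ᵥ A *ᵥ x ≤ c * (x ⬝ᵥ x) := by
  have := h.dotProduct_mulVec_nonneg_real x
  simp only [sub_mulVec, smul_mulVec, one_mulVec, dotProduct_sub, dotProduct_smul,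
    smul_eq_mul] at this
  linarith

theorem dotProduct_self_le_mul_inv_mulVec {ι : Type*} [Fintype ι] [DecidableEq ι]
    {A : Matrix ι ι ℝ} {c : ℝ} (hA : A.PosDef) (hc : 0 ≤ c)
    (h : (c • (1 : Matrix ι ι ℝ) - A).PosSemidef) (x : ι → ℝ) :
    x ⬝ᵥ x ≤ c * (x ⬝ᵥ A⁻¹ *ᵥ x) := by
  have hAw : A *ᵥ (A⁻¹ *ᵥ x) = x := by
    rw [mulVec_mulVec, mul_nonsing_inv _ ((isUnit_iff_isUnit_det _).1 hA.isUnit), one_mulVec]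
  have hcs := hA.posSemidef.dotProduct_mulVec_sq_le x (A⁻¹ *ᵥ x)
  rw [hAw, dotProduct_comm (A⁻¹ *ᵥ x) x] at hcs
  have hq : 0 ≤ x ⬝ᵥ A⁻¹ *ᵥ x := hA.inv.posSemidef.dotProduct_mulVec_nonneg_real x
  have hle := mul_le_mul_of_nonneg_right (dotProduct_mulVec_le_of_smul_one_sub_posSemidef h x) hq
  by_contra! hlt
  have hpos : 0 < x ⬝ᵥ x := lt_of_le_of_lt (mul_nonneg hc hq) hlt
  nlinarith

theorem EuclideanSpace.dotProduct_self_eq_norm_sq {ι : Type*} [Fintype ι]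
    (x : EuclideanSpace ℝ ι) : x.ofLp ⬝ᵥ x.ofLp = ‖x‖ ^ 2 := by
  rw [← real_inner_self_eq_norm_sq, EuclideanSpace.inner_eq_star_dotProduct]
  simp

theorem EuclideanSpace.neg_dotProduct_le_norm_mul_norm {ι : Type*} [Fintype ι]
    (x y : EuclideanSpace ℝ ι) : -(x.ofLp ⬝ᵥ y.ofLp) ≤ ‖x‖ * ‖y‖ := by
  have h := (abs_le.1 (abs_real_inner_le_norm x y)).1
  rw [EuclideanSpace.inner_eq_star_dotProduct, star_trivial, dotProduct_comm] at h
  linarith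

/-- bound on the damping-plus-disturbance term
`-σ·θ̃ᵀθ̂ + eᵀM d ≤ -σ‖θ̃‖² + d̄_a·√V` for the adaptive Lyapunov function
`V = eᵀM e + θ̃ᵀΓ⁻¹θ̃` with `d̄_a = σ√γ̄·θ̄ + d̄/√ω`. -/
theorem stmt_4 (n p : ℕ) (ω ωb γ γb : ℝ)
    (hω : 0 < ω) (hωb : 0 < ωb) (hγ : 0 < γ) (hγb : 0 < γb)
    (M : Matrix (Fin n) (Fin n) ℝ) (hMsymm : M.IsHermitian)
    (hMlb : (M - (1 / ωb) • (1 : Matrix (Fin n) (Fin n) ℝ)).PosSemidef)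
    (hMub : ((1 / ω) • (1 : Matrix (Fin n) (Fin n) ℝ) - M).PosSemidef)
    (Γ : Matrix (Fin p) (Fin p) ℝ) (hΓ : Γ.PosDef)
    (hΓlb : (Γ - γ • (1 : Matrix (Fin p) (Fin p) ℝ)).PosSemidef)
    (hΓub : (γb • (1 : Matrix (Fin p) (Fin p) ℝ) - Γ).PosSemidef)
    (θb : ℝ) (θ : EuclideanSpace ℝ (Fin p)) (hθ : ‖θ‖ ≤ θb)
    (e : EuclideanSpace ℝ (Fin n)) (θt θh : EuclideanSpace ℝ (Fin p)) (hθh : θh = θt + θ)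
    (db : ℝ) (d : EuclideanSpace ℝ (Fin n)) (hd : ‖d‖ ≤ db)
    (σ : ℝ) (hσ : 0 ≤ σ) (V da : ℝ)
    (hV : V = e ⬝ᵥ M.mulVec e + θt ⬝ᵥ Γ⁻¹.mulVec θt)
    (hda : da = σ * Real.sqrt γb * θb + db / Real.sqrt ω) :
    -σ * (θt ⬝ᵥ θh) + e ⬝ᵥ M.mulVec d ≤ -σ * ‖θt‖ ^ 2 + da * Real.sqrt V := by
  have hM : M.PosSemidef := by
    have := hMlb.add ((PosSemidef.one (n := Fin n) (R := ℝ)).smul (one_div_pos.2 hωb).le)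
    simpa using this
  have he : 0 ≤ e ⬝ᵥ M.mulVec e := hM.dotProduct_mulVec_nonneg_real _
  have hθt : 0 ≤ θt ⬝ᵥ Γ⁻¹.mulVec θt := hΓ.inv.posSemidef.dotProduct_mulVec_nonneg_real _
  have hV0 : 0 ≤ V := by rw [hV]; exact add_nonneg he hθt
  have hdb : 0 ≤ db := (norm_nonneg d).trans hd
  have hdist : e ⬝ᵥ M.mulVec d ≤ db / √ω * √V := by
    refine le_of_sq_le_sq ?_ (by positivity)
    have hdd : d ⬝ᵥ M.mulVec d ≤ db ^ 2 / ω := by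
      refine (dotProduct_mulVec_le_of_smul_one_sub_posSemidef hMub d).trans ?_
      rw [EuclideanSpace.dotProduct_self_eq_norm_sq, one_div_mul_eq_div]
      gcongr
    calc (e ⬝ᵥ M.mulVec d) ^ 2 ≤ (e ⬝ᵥ M.mulVec e) * (d ⬝ᵥ M.mulVec d) :=
          hM.dotProduct_mulVec_sq_le _ _
      _ ≤ V * (db ^ 2 / ω) :=
          mul_le_mul (by linarith) hdd (hM.dotProduct_mulVec_nonneg_real _) hV0
      _ = (db / √ω * √V) ^ 2 := by
          rw [mul_pow, div_pow, Real.sq_sqrt hω.le, Real.sq_sqrt hV0, mul_comm]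
  have hnorm : ‖θt‖ ≤ √γb * √V := by
    rw [← Real.sqrt_mul hγb.le]
    refine Real.le_sqrt_of_sq_le ?_
    rw [← EuclideanSpace.dotProduct_self_eq_norm_sq]
    exact (dotProduct_self_le_mul_inv_mulVec hΓ hγb.le hΓub _).trans
      (mul_le_mul_of_nonneg_left (by linarith) hγb.le)
  have hdamp : -(θt ⬝ᵥ θ) ≤ √γb * √V * θb :=
    (EuclideanSpace.neg_dotProduct_le_norm_mul_norm θt θ).trans
      (mul_le_mul hnorm hθ (norm_nonneg _) (by positivity))
  have hsplit : θt ⬝ᵥ θh = ‖θt‖ ^ 2 + θt ⬝ᵥ θ := by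
    rw [hθh, WithLp.ofLp_add, dotProduct_add, EuclideanSpace.dotProduct_self_eq_norm_sq]
  rw [hsplit, hda]
  linarith [mul_le_mul_of_nonneg_left hdamp hσ]
end

section
/- Let α > 0 and d̄ ≥ 0, and let V : [0, ∞) → ℝ be differentiable with V(t) ≥ 0 and V'(t) ≤ -2α·V(t) + 2·d̄·√(V(t)) for all t ≥ 0. Then for all t ≥ 0, √(V(t)) ≤ √(V(0))·e^{-αt} + (d̄/α)·(1 - e^{-αt}). -/
/-- the comparison-lemma step: from `V' ≤ -2α·V + 2d̄·√V` on `[0,∞)` with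
`V ≥ 0` one gets `√(V t) ≤ √(V 0)·e^{-αt} + (d̄/α)·(1 - e^{-αt})`. -/
theorem stmt_7 (α db : ℝ) (hα : 0 < α) (hdb : 0 ≤ db)
    (V V' : ℝ → ℝ)
    (hVnn : ∀ t, 0 ≤ t → 0 ≤ V t)
    (hderiv : ∀ t, 0 ≤ t → HasDerivWithinAt V (V' t) (Set.Ici 0) t)
    (hineq : ∀ t, 0 ≤ t → V' t ≤ -2 * α * V t + 2 * db * Real.sqrt (V t)) :
    ∀ t, 0 ≤ t →
      Real.sqrt (V t) ≤
        Real.sqrt (V 0) * Real.exp (-α * t) + (db / α) * (1 - Real.exp (-α * t)) := by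
  intro t ht
  set g : ℝ → ℝ := fun s ↦
    Real.sqrt (V 0) * Real.exp (-α * s) + (db / α) * (1 - Real.exp (-α * s)) with hg
  have hg_nonneg : ∀ s, 0 ≤ s → 0 ≤ g s := fun s hs ↦ by
    have hexp : Real.exp (-α * s) ≤ 1 := Real.exp_le_one_iff.2 (by nlinarith)
    have hone : 0 ≤ 1 - Real.exp (-α * s) := sub_nonneg.2 hexp
    positivity
  have hg_deriv : ∀ s, HasDerivAt g (-α * g s + db) s := fun s ↦ by
    have hexp : HasDerivAt (fun s ↦ Real.exp (-α * s)) (Real.exp (-α * s) * (-α * 1)) s :=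
      ((hasDerivAt_id s).const_mul (-α)).exp
    refine ((hexp.const_mul (Real.sqrt (V 0))).add
      ((hexp.const_sub 1).const_mul (db / α))).congr_deriv ?_
    simp only [hg]
    field_simp
    ring
  refine le_of_forall_pos_le_add fun ε hε ↦ ?_
  have hV : V t ≤ (g t + ε) ^ 2 := by
    refine image_le_of_deriv_right_lt_deriv_boundary (a := 0) (b := t)
      (B := fun s ↦ (g s + ε) ^ 2) (B' := fun s ↦ 2 * (g s + ε) * (-α * g s + db))
      (fun s hs ↦ (hderiv s hs.1).continuousWithinAt.mono Set.Icc_subset_Ici_self)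
      (fun s hs ↦ (hderiv s hs.1).mono (Set.Ici_subset_Ici.2 hs.1)) ?_
      (fun s ↦ ?_) (fun s hs hVs ↦ ?_) ⟨ht, le_rfl⟩
    · have hg_zero : g 0 = Real.sqrt (V 0) := by simp [hg]
      have hsq := Real.sq_sqrt (hVnn 0 le_rfl)
      simp only [hg_zero]
      nlinarith [Real.sqrt_nonneg (V 0)]
    · simpa using ((hg_deriv s).add_const ε).fun_pow 2
    · have hpos : 0 < g s + ε := add_pos_of_nonneg_of_pos (hg_nonneg s hs.1) hε
      have hineq_s := hineq s hs.1
      rw [hVs, Real.sqrt_sq hpos.le] at hineq_s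
      nlinarith [mul_pos (mul_pos hα hε) hpos]
  exact Real.sqrt_le_iff.2 ⟨add_nonneg (hg_nonneg t ht) hε.le, hV⟩
end
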